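/- arXiv:2207.14771 — 4 statements merged into one kernel-verified Lean document; each statement's English description precedes it below -/
import Mathlib

section
/- Let α ∈ ℝ and x₀ ∈ ℤ, and define ψ : ℤ × ℝ → ℂ by ψ(x,t) = e^{-iα(x-x₀)} · i^{x-x₀} · J_{x-x₀}(2t). Then ψ(x,0) = 1 if x = x₀ and ψ(x,0) = 0 otherwise, and for every x ∈ ℤ and t ∈ ℝ, the time derivative satisfies ∂ψ(x,t)/∂t = i·(e^{iα} ψ(x+1,t) + e^{-iα} ψ(x-1,t)); that is, ψ solves the Schrödinger equation of the continuous-time quantum walk on the directed infinite line with initial state localized at x₀. -/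
open scoped Real

/-- Bessel function of the first kind of integer order `n`:
`J_n(x) = (1/π) ∫₀^π cos (n τ - x sin τ) dτ`. -/
noncomputable def besselJ (n : ℤ) (x : ℝ) : ℝ :=
  (1 / Real.pi) * ∫ τ in (0 : ℝ)..Real.pi, Real.cos (n * τ - x * Real.sin τ)

/-- The wave function `ψ(x,t) = e^{-iα(x-x₀)} i^{x-x₀} J_{x-x₀}(2t)` of the directed
quantum walk on the infinite line. -/
noncomputable def psi (α : ℝ) (x₀ : ℤ) (x : ℤ) (t : ℝ) : ℂ :=
  Complex.exp (-(Complex.I * α * ((x : ℂ) - (x₀ : ℂ)))) * Complex.I ^ (x - x₀)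
    * (besselJ (x - x₀) (2 * t) : ℂ)

theorem besselJ_hasDerivAt (n : ℤ) (x : ℝ) :
    HasDerivAt (besselJ n) ((besselJ (n - 1) x - besselJ (n + 1) x) / 2) x := by
  have h := (intervalIntegral.hasDerivAt_integral_of_dominated_loc_of_deriv_le
    (μ := MeasureTheory.volume) (a := 0) (b := Real.pi)
    (F := fun x τ : ℝ => Real.cos (n * τ - x * Real.sin τ))
    (F' := fun x τ : ℝ => Real.sin (n * τ - x * Real.sin τ) * Real.sin τ)
    (x₀ := x) (s := Set.univ) (bound := fun _ => (1 : ℝ)) Filter.univ_mem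
    (Filter.Eventually.of_forall fun y =>
      (by fun_prop : Continuous fun τ : ℝ =>
        Real.cos (n * τ - y * Real.sin τ)).aestronglyMeasurable)
    ((by fun_prop : Continuous fun τ : ℝ =>
        Real.cos (n * τ - x * Real.sin τ)).intervalIntegrable _ _)
    ((by fun_prop : Continuous fun τ : ℝ =>
        Real.sin (n * τ - x * Real.sin τ) * Real.sin τ).aestronglyMeasurable)
    (Filter.Eventually.of_forall fun τ _ y _ => by
      rw [norm_mul]
      exact mul_le_one₀ (Real.abs_sin_le_one _) (norm_nonneg _) (Real.abs_sin_le_one _))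
    (by simp)
    (Filter.Eventually.of_forall fun τ _ y _ => by
      have h1 : HasDerivAt (fun y : ℝ => n * τ - y * Real.sin τ) (-(1 * Real.sin τ)) y :=
        ((hasDerivAt_id y).mul_const (Real.sin τ)).const_sub _
      refine h1.cos.congr_deriv ?_
      ring)).2
  have h2 := h.const_mul (1 / Real.pi)
  unfold besselJ
  refine h2.congr_deriv ?_
  symm
  rw [← mul_sub, ← intervalIntegral.integral_sub, mul_div_assoc,
    ← intervalIntegral.integral_div]
  · congr 2
    ext τ
    have e1 : ((n - 1 : ℤ) : ℝ) * τ - x * Real.sin τ = (n * τ - x * Real.sin τ) - τ := by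
      push_cast; ring
    have e2 : ((n + 1 : ℤ) : ℝ) * τ - x * Real.sin τ = (n * τ - x * Real.sin τ) + τ := by
      push_cast; ring
    rw [e1, e2, Real.cos_sub, Real.cos_add]
    ring
  · exact Continuous.intervalIntegrable (by fun_prop) _ _
  · exact Continuous.intervalIntegrable (by fun_prop) _ _

theorem besselJ_zero_arg (n : ℤ) : besselJ n 0 = if n = 0 then 1 else 0 := by
  unfold besselJ
  split_ifs with h
  · subst h
    simp [Real.pi_ne_zero]
  · have hn : (n : ℝ) ≠ 0 := by exact_mod_cast h
    simp only [zero_mul, sub_zero]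
    rw [intervalIntegral.integral_comp_mul_left (fun y => Real.cos y) hn]
    simp [Real.sin_int_mul_pi]

/-- `ψ` as above satisfies the initial condition localized at `x₀` and solves the
Schrödinger equation `∂ψ/∂t = i (e^{iα} ψ(x+1,t) + e^{-iα} ψ(x-1,t))` of the
continuous-time quantum walk on the directed infinite line. -/
theorem psi_solves_schrodinger (α : ℝ) (x₀ : ℤ) :
    (∀ x : ℤ, psi α x₀ x 0 = if x = x₀ then 1 else 0) ∧
    (∀ (x : ℤ) (t : ℝ),
      HasDerivAt (fun s : ℝ => psi α x₀ x s)
        (Complex.I * (Complex.exp (Complex.I * α) * psi α x₀ (x + 1) t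
          + Complex.exp (-(Complex.I * α)) * psi α x₀ (x - 1) t)) t) := by
  constructor
  · intro x
    unfold psi
    rw [mul_zero, besselJ_zero_arg]
    by_cases h : x = x₀
    · subst h; simp
    · simp [h, sub_eq_zero]
  · intro x t
    have h1 : HasDerivAt (fun s : ℝ => besselJ (x - x₀) (2 * s)) _ t :=
      (besselJ_hasDerivAt (x - x₀) (2 * t)).comp t ((hasDerivAt_id t).const_mul 2)
    have h2 := h1.ofReal_comp.const_mul
      (Complex.exp (-(Complex.I * α * ((x : ℂ) - (x₀ : ℂ)))) * Complex.I ^ (x - x₀))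
    unfold psi
    refine h2.congr_deriv ?_
    symm
    have a1 : x + 1 - x₀ = (x - x₀) + 1 := by ring
    have a2 : x - 1 - x₀ = (x - x₀) - 1 := by ring
    rw [a1, a2, zpow_add_one₀ Complex.I_ne_zero, zpow_sub_one₀ Complex.I_ne_zero]
    have b1 : Complex.exp (-(Complex.I * α * (((x + 1 : ℤ) : ℂ) - (x₀ : ℂ))))
        = Complex.exp (-(Complex.I * α * ((x : ℂ) - (x₀ : ℂ)))) * Complex.exp (-(Complex.I * α)) := by
      rw [← Complex.exp_add]; congr 1; push_cast; ring
    have b2 : Complex.exp (-(Complex.I * α * (((x - 1 : ℤ) : ℂ) - (x₀ : ℂ))))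
        = Complex.exp (-(Complex.I * α * ((x : ℂ) - (x₀ : ℂ)))) * Complex.exp (Complex.I * α) := by
      rw [← Complex.exp_add]; congr 1; push_cast; ring
    have c : Complex.exp (Complex.I * α) * Complex.exp (-(Complex.I * α)) = 1 := by
      rw [← Complex.exp_add]; simp
    rw [b1, b2, Complex.inv_I]
    push_cast
    generalize Complex.exp (-(Complex.I * α * ((x : ℂ) - (x₀ : ℂ)))) = E at *
    generalize Complex.exp (-(Complex.I * α)) = A at *
    generalize Complex.exp (Complex.I * α) = B at *
    generalize Complex.I ^ (x - x₀) = P at *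
    generalize (besselJ (x - x₀ + 1) (2 * t) : ℂ) = U
    generalize (besselJ (x - x₀ - 1) (2 * t) : ℂ) = V
    linear_combination (E * P * (U - V) * Complex.I ^ 2) * c + E * P * (U - V) * Complex.I_sq
end

section
/- Let α, γ, θ, t ∈ ℝ and k ∈ ℤ, and define P_k(x,t) = cos²θ · J_{x+k}(2t)² + sin²θ · J_{x-k}(2t)² + 2(−1)^k cos(2αk + γ) · cos θ sin θ · J_{x+k}(2t) J_{x-k}(2t). Then the function x ↦ x·P_k(x,t) is summable over ℤ and ∑_{x ∈ ℤ} x·P_k(x,t) = −k·cos(2θ). In particular, the first moment of the walker's position does not depend on the direction phase α, on the relative phase γ, or on the time t. -/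
open scoped Real

/-- The probability distribution of the directed quantum walk started from
`cos θ |-k⟩ + e^{iγ} sin θ |k⟩` (equation (19) of the paper). -/
noncomputable def P (α γ θ : ℝ) (k x : ℤ) (t : ℝ) : ℝ :=
  Real.cos θ ^ 2 * besselJ (x + k) (2 * t) ^ 2
    + Real.sin θ ^ 2 * besselJ (x - k) (2 * t) ^ 2
    + 2 * (-1 : ℝ) ^ k * Real.cos (2 * α * k + γ) * Real.cos θ * Real.sin θ
        * besselJ (x + k) (2 * t) * besselJ (x - k) (2 * t)

lemma bJ_rec (n : ℤ) (z : ℝ) :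
    (n : ℝ) * besselJ n z = z / 2 * (besselJ (n - 1) z + besselJ (n + 1) z) := by
  have h : ∫ τ in (0 : ℝ)..Real.pi,
      Real.cos (n * τ - z * Real.sin τ) * (n - z * Real.cos τ) = 0 := by
    rw [intervalIntegral.integral_eq_sub_of_hasDerivAt
      (f := fun τ => Real.sin (n * τ - z * Real.sin τ))]
    · simp [Real.sin_int_mul_pi]
    · intro τ _
      have h1 : HasDerivAt (fun τ : ℝ => n * τ - z * Real.sin τ) (n * 1 - z * Real.cos τ) τ :=
        ((hasDerivAt_id τ).const_mul (n : ℝ)).sub ((Real.hasDerivAt_sin τ).const_mul z)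
      simpa using h1.sin
    · apply Continuous.intervalIntegrable; fun_prop
  have e : ∀ τ : ℝ, Real.cos (n * τ - z * Real.sin τ) * (n - z * Real.cos τ)
      = n * Real.cos (n * τ - z * Real.sin τ)
        - z / 2 * (Real.cos ((n - 1 : ℤ) * τ - z * Real.sin τ)
          + Real.cos ((n + 1 : ℤ) * τ - z * Real.sin τ)) := by
    intro τ
    have e1 : ((n - 1 : ℤ) : ℝ) * τ - z * Real.sin τ = (n * τ - z * Real.sin τ) - τ := by
      push_cast; ring
    have e2 : ((n + 1 : ℤ) : ℝ) * τ - z * Real.sin τ = (n * τ - z * Real.sin τ) + τ := by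
      push_cast; ring
    rw [e1, e2, Real.cos_sub _ τ, Real.cos_add]; ring
  simp_rw [e] at h
  have ii : ∀ m : ℤ, IntervalIntegrable (fun τ : ℝ => Real.cos (m * τ - z * Real.sin τ))
      MeasureTheory.volume 0 Real.pi := by
    intro m; apply Continuous.intervalIntegrable; fun_prop
  rw [intervalIntegral.integral_sub ((ii n).const_mul _) (((ii _).add (ii _)).const_mul _),
    intervalIntegral.integral_const_mul, intervalIntegral.integral_const_mul,
    intervalIntegral.integral_add (ii _) (ii _)] at h
  unfold besselJ
  linear_combination (1 / Real.pi) * h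

lemma bJ_neg (n : ℤ) (z : ℝ) : besselJ (-n) z = (-1 : ℝ) ^ n * besselJ n z := by
  unfold besselJ
  have h := intervalIntegral.integral_comp_sub_left (a := 0) (b := Real.pi)
    (fun τ : ℝ => Real.cos ((-n : ℤ) * τ - z * Real.sin τ)) Real.pi
  simp only [sub_self, sub_zero] at h
  rw [← h, mul_left_comm, ← intervalIntegral.integral_const_mul ((-1 : ℝ) ^ n)]
  congr 1
  refine intervalIntegral.integral_congr (fun τ _ => ?_)
  rw [Real.sin_pi_sub]
  have : ((-n : ℤ) : ℝ) * (Real.pi - τ) - z * Real.sin τ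
      = (n * τ - z * Real.sin τ) - n * Real.pi := by push_cast; ring
  rw [this, Real.cos_sub_int_mul_pi]

noncomputable def genF (z : ℝ) : C(AddCircle (2 * Real.pi), ℂ) :=
  ⟨fun x => Complex.exp (Complex.I * z * ((fourier 1 x : ℂ).im : ℂ)), by fun_prop⟩

lemma genF_norm (z : ℝ) (x) : ‖genF z x‖ = 1 := by
  simp only [genF, ContinuousMap.coe_mk]
  have : Complex.I * z * ((fourier 1 x : ℂ).im : ℂ) = ((z * (fourier 1 x : ℂ).im : ℝ) : ℂ) * Complex.I := by
    push_cast; ring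
  rw [this, Complex.norm_exp_ofReal_mul_I]

instance fact_two_pi_pos' : Fact (0 < 2 * Real.pi) := ⟨Real.two_pi_pos⟩

lemma genF_coe (z τ : ℝ) : genF z (τ : AddCircle (2 * Real.pi)) =
    Complex.exp (Complex.I * z * (Real.sin τ : ℂ)) := by
  simp only [genF, ContinuousMap.coe_mk, fourier_coe_apply]
  have : 2 * (Real.pi : ℂ) * Complex.I * (1 : ℤ) * τ / ((2 * Real.pi : ℝ) : ℂ) = τ * Complex.I := by
    have : (Real.pi : ℂ) ≠ 0 := by exact_mod_cast Real.pi_ne_zero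
    push_cast; field_simp
  rw [this, Complex.exp_ofReal_mul_I_im]

lemma coeff_genF (n : ℤ) (z : ℝ) : fourierCoeff (genF z) n = (besselJ n z : ℂ) := by
  rw [fourierCoeff_eq_intervalIntegral _ _ (-Real.pi)]
  have e : ∀ τ : ℝ, (fourier (-n) (τ : AddCircle (2 * Real.pi)) : ℂ) • genF z τ =
      Complex.exp (-((n * τ - z * Real.sin τ : ℝ) : ℂ) * Complex.I) := by
    intro τ
    rw [genF_coe, fourier_coe_apply, smul_eq_mul, ← Complex.exp_add]
    congr 1
    have : (Real.pi : ℂ) ≠ 0 := by exact_mod_cast Real.pi_ne_zero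
    push_cast; field_simp; ring
  simp_rw [e]
  have e2 : -Real.pi + 2 * Real.pi = Real.pi := by ring
  have ii : ∀ a b : ℝ, IntervalIntegrable (fun τ : ℝ =>
      Complex.exp (-((n * τ - z * Real.sin τ : ℝ) : ℂ) * Complex.I)) MeasureTheory.volume a b := by
    intro a b; apply Continuous.intervalIntegrable; fun_prop
  have ii' : IntervalIntegrable (fun τ : ℝ =>
      Complex.exp (((n * τ - z * Real.sin τ : ℝ) : ℂ) * Complex.I)) MeasureTheory.volume 0 Real.pi := by
    apply Continuous.intervalIntegrable; fun_prop
  have h := intervalIntegral.integral_comp_neg (a := 0) (b := Real.pi) (fun τ : ℝ =>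
      Complex.exp (-((n * τ - z * Real.sin τ : ℝ) : ℂ) * Complex.I))
  have e3 : ∀ τ : ℝ, -((n * (-τ) - z * Real.sin (-τ) : ℝ) : ℂ)
      = ((n * τ - z * Real.sin τ : ℝ) : ℂ) := by
    intro τ; rw [Real.sin_neg]; push_cast; ring
  simp_rw [e3] at h
  rw [neg_zero] at h
  rw [e2, ← intervalIntegral.integral_add_adjacent_intervals (ii (-Real.pi) 0) (ii 0 Real.pi), ← h,
    ← intervalIntegral.integral_add ii' (ii 0 Real.pi)]
  simp_rw [← Complex.two_cos, ← Complex.ofReal_cos]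
  rw [intervalIntegral.integral_const_mul, intervalIntegral.integral_ofReal]
  unfold besselJ
  have : (Real.pi : ℂ) ≠ 0 := by exact_mod_cast Real.pi_ne_zero
  rw [Complex.real_smul]
  push_cast; field_simp

lemma bJ_sq (z : ℝ) : HasSum (fun n : ℤ => besselJ n z ^ 2) 1 := by
  have h := hasSum_sq_fourierCoeff (ContinuousMap.toLp 2 AddCircle.haarAddCircle ℂ (genF z))
  simp_rw [fourierCoeff_toLp, coeff_genF] at h
  convert h using 1
  · ext n; simp
  · rw [MeasureTheory.integral_congr_ae (g := fun _ => (1 : ℝ))]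
    · simp
    · filter_upwards [ContinuousMap.coeFn_toLp (p := 2) (𝕜 := ℂ) AddCircle.haarAddCircle (genF z)] with x hx
      rw [hx, genF_norm]; simp

lemma hs_congr {f g : ℤ → ℝ} {a b : ℝ} (h : HasSum f a) (hf : ∀ x, g x = f x) (hb : b = a) :
    HasSum g b := by
  obtain rfl : g = f := funext hf
  rw [hb]; exact h

lemma hs_shift {f : ℤ → ℝ} {a : ℝ} (h : HasSum f a) (k : ℤ) :
    HasSum (fun x => f (x + k)) a := (Equiv.addRight k).hasSum_iff.2 h

lemma sm_add {f : ℤ → ℝ} (h : Summable f) (k : ℤ) :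
    Summable (fun x => f (x + k)) := (hs_shift h.hasSum k).summable

lemma sm_sub {f : ℤ → ℝ} (h : Summable f) (k : ℤ) :
    Summable (fun x => f (x - k)) := sm_add h (-k)

lemma bJ_nsq (z : ℝ) : Summable (fun n : ℤ => ((n : ℝ) * besselJ n z) ^ 2) := by
  have s := (bJ_sq z).summable
  have s1 : Summable (fun n : ℤ => besselJ (n - 1) z ^ 2) :=
    sm_sub (f := fun n : ℤ => besselJ n z ^ 2) s 1
  have s2 : Summable (fun n : ℤ => besselJ (n + 1) z ^ 2) :=
    sm_add (f := fun n : ℤ => besselJ n z ^ 2) s 1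
  refine Summable.of_nonneg_of_le (fun _ => sq_nonneg _) (fun n => ?_)
    ((s1.add s2).mul_left (z ^ 2 / 2))
  rw [bJ_rec]
  nlinarith [sq_nonneg (z * (besselJ (n - 1) z - besselJ (n + 1) z))]

lemma summable_prod {f g : ℤ → ℝ} (hf : Summable fun n => f n ^ 2)
    (hg : Summable fun n => g n ^ 2) : Summable fun n => f n * g n := by
  refine Summable.of_norm_bounded (hf.add hg) (fun n => ?_)
  rw [Real.norm_eq_abs, abs_le]
  constructor <;> nlinarith [sq_nonneg (f n + g n), sq_nonneg (f n - g n),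
    sq_nonneg (f n), sq_nonneg (g n)]

lemma bJ_cross (z : ℝ) (k : ℤ) :
    HasSum (fun x : ℤ => (x : ℝ) * (besselJ (x + k) z * besselJ (x - k) z)) 0 := by
  have s := (bJ_sq z).summable
  have a0 : Summable (fun x : ℤ => besselJ (x + k) z ^ 2) :=
    sm_add (f := fun n : ℤ => besselJ n z ^ 2) s k
  have a1 : Summable (fun x : ℤ => (((x + k : ℤ) : ℝ) * besselJ (x + k) z) ^ 2) :=
    sm_add (f := fun n : ℤ => ((n : ℝ) * besselJ n z) ^ 2) (bJ_nsq z) k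
  have b0 : Summable (fun x : ℤ => besselJ (x - k) z ^ 2) :=
    sm_sub (f := fun n : ℤ => besselJ n z ^ 2) s k
  have hs : Summable (fun x : ℤ => (x : ℝ) * (besselJ (x + k) z * besselJ (x - k) z)) := by
    refine ((summable_prod a1 b0).sub ((summable_prod a0 b0).mul_left (k : ℝ))).congr
      (fun x => ?_)
    push_cast; ring
  have hodd : ∀ x : ℤ, ((-x : ℤ) : ℝ) * (besselJ (-x + k) z * besselJ (-x - k) z)
      = -((x : ℝ) * (besselJ (x + k) z * besselJ (x - k) z)) := by
    intro x
    have e1 : -x + k = -(x - k) := by ring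
    have e2 : -x - k = -(x + k) := by ring
    have e3 : (-1 : ℝ) ^ (x - k) * (-1 : ℝ) ^ (x + k) = 1 := by
      rw [← zpow_add₀ (by norm_num), show x - k + (x + k) = 2 * x by ring, zpow_mul]
      norm_num
    rw [e1, e2, bJ_neg, bJ_neg]
    push_cast
    linear_combination (-(x : ℝ) * (besselJ (x + k) z * besselJ (x - k) z)) * e3
  have h := (Equiv.neg ℤ).tsum_eq
    (fun x : ℤ => (x : ℝ) * (besselJ (x + k) z * besselJ (x - k) z))
  simp only [Equiv.neg_apply, hodd, tsum_neg] at h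
  have h0 : ∑' x : ℤ, (x : ℝ) * (besselJ (x + k) z * besselJ (x - k) z) = 0 := by linarith
  rw [← h0]
  exact hs.hasSum

lemma bJ_shift (z : ℝ) (k : ℤ) :
    HasSum (fun x : ℤ => (x : ℝ) * besselJ (x + k) z ^ 2) (-(k : ℝ)) := by
  have h1 := bJ_cross z 0
  simp only [add_zero, sub_zero] at h1
  have h2 := hs_shift h1 k
  have h3 := hs_shift (bJ_sq z) k
  refine hs_congr (h2.sub (h3.mul_left (k : ℝ))) (fun x => ?_) (by ring)
  push_cast; ring

/-- The first moment of the walker's position is `-k cos 2θ`: it does not depend on the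
direction phase `α`, on the relative phase `γ`, or on the time `t`. -/
theorem first_moment (α γ θ t : ℝ) (k : ℤ) :
    Summable (fun x : ℤ => (x : ℝ) * P α γ θ k x t) ∧
    ∑' x : ℤ, (x : ℝ) * P α γ θ k x t = -(k : ℝ) * Real.cos (2 * θ) := by
  have h : HasSum (fun x : ℤ => (x : ℝ) * P α γ θ k x t) (-(k : ℝ) * Real.cos (2 * θ)) := by
    have h1 := (bJ_shift (2 * t) k).mul_left (Real.cos θ ^ 2)
    have h2 := (bJ_shift (2 * t) (-k)).mul_left (Real.sin θ ^ 2)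
    have h3 := (bJ_cross (2 * t) k).mul_left
      (2 * (-1 : ℝ) ^ k * Real.cos (2 * α * k + γ) * Real.cos θ * Real.sin θ)
    refine hs_congr ((h1.add h2).add h3) (fun x => ?_) ?_
    · rw [← sub_eq_add_neg]
      unfold P; ring
    · rw [Real.cos_two_mul']; push_cast; ring
  exact ⟨h.summable, h.tsum_eq⟩
end

section
/- For every z ∈ ℝ and every k ∈ ℤ, the function x ↦ x²·J_{x+k}(z)² is summable over ℤ and ∑_{x ∈ ℤ} x²·J_{x+k}(z)² = z²/2 + k². -/
open scoped Real

/-- The generating kernel of the Bessel functions. -/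
noncomputable def besselKernel (n : ℤ) (z : ℝ) (t : ℝ) : ℂ :=
  Complex.exp (((z * Real.sin t - n * t : ℝ) : ℂ) * Complex.I)

lemma besselKernel_cont (n : ℤ) (z : ℝ) : Continuous (besselKernel n z) := by
  unfold besselKernel
  fun_prop

lemma besselKernel_add_neg (n : ℤ) (z t : ℝ) :
    besselKernel n z (-t) + besselKernel n z t
      = ((2 * Real.cos (n * t - z * Real.sin t) : ℝ) : ℂ) := by
  have h1 : (z * Real.sin (-t) - n * (-t) : ℝ) = n * t - z * Real.sin t := by
    rw [Real.sin_neg]; ring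
  have h2 : (z * Real.sin t - n * t : ℝ) = -(n * t - z * Real.sin t) := by ring
  unfold besselKernel
  rw [h1, h2]
  generalize (n * t - z * Real.sin t : ℝ) = u
  push_cast
  rw [Complex.two_cos]

lemma integral_besselKernel (n : ℤ) (z : ℝ) :
    ∫ t in (-π)..π, besselKernel n z t = ((2 * π * besselJ n z : ℝ) : ℂ) := by
  have hi : ∀ a b, IntervalIntegrable (besselKernel n z) MeasureTheory.volume a b :=
    fun a b => (besselKernel_cont n z).intervalIntegrable a b
  have hc : Continuous (fun t => besselKernel n z (-t)) :=
    (besselKernel_cont n z).comp continuous_neg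
  have h0 : ∫ t in (-π)..0, besselKernel n z t = ∫ t in (0:ℝ)..π, besselKernel n z (-t) := by
    rw [intervalIntegral.integral_comp_neg, neg_zero]
  rw [← intervalIntegral.integral_add_adjacent_intervals (hi (-π) 0) (hi 0 π), h0,
    ← intervalIntegral.integral_add (hc.intervalIntegrable _ _) (hi _ _)]
  simp_rw [besselKernel_add_neg]
  rw [intervalIntegral.integral_ofReal, intervalIntegral.integral_const_mul]
  unfold besselJ
  congr 1
  have := Real.pi_ne_zero
  field_simp

lemma hasDerivAt_besselKernel (n : ℤ) (z t : ℝ) :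
    HasDerivAt (besselKernel n z)
      (((z * Real.cos t - n : ℝ) : ℂ) * Complex.I * besselKernel n z t) t := by
  have h1 : HasDerivAt (fun t : ℝ => (z * Real.sin t - n * t : ℝ)) (z * Real.cos t - n) t := by
    have := ((Real.hasDerivAt_sin t).const_mul z).sub ((hasDerivAt_id t).const_mul (n:ℝ))
    rw [mul_one] at this
    exact this
  have h2 := (h1.ofReal_comp.mul_const Complex.I).cexp
  unfold besselKernel
  convert h2 using 1
  ring

lemma besselKernel_pi (n : ℤ) (z : ℝ) : besselKernel n z π = besselKernel n z (-π) := by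
  unfold besselKernel
  rw [Complex.exp_eq_exp_iff_exists_int]
  refine ⟨-n, ?_⟩
  simp
  ring

lemma integral_mul_besselKernel (n : ℤ) (z : ℝ) :
    ∫ t in (-π)..π, ((z * Real.cos t - n : ℝ) : ℂ) * besselKernel n z t = 0 := by
  have hk := besselKernel_cont n z
  have h := intervalIntegral.integral_eq_sub_of_hasDerivAt (a := -π) (b := π)
    (fun t _ => hasDerivAt_besselKernel n z t)
    (Continuous.intervalIntegrable (by fun_prop) _ _)
  rw [besselKernel_pi, sub_self] at h
  have e : ∀ t : ℝ, ((z * Real.cos t - n : ℝ) : ℂ) * Complex.I * besselKernel n z t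
      = Complex.I * (((z * Real.cos t - n : ℝ) : ℂ) * besselKernel n z t) := fun t => by ring
  simp_rw [e] at h
  rw [intervalIntegral.integral_const_mul] at h
  exact (mul_eq_zero.mp h).resolve_left Complex.I_ne_zero

lemma besselCoeff (z : ℝ) (k x : ℤ) (hab : -π < π) :
    fourierCoeffOn hab (fun t => ((z * Real.cos t - k : ℝ) : ℂ) * besselKernel k z t) x
      = ((x * besselJ (x + k) z : ℝ) : ℂ) := by
  rw [fourierCoeffOn_eq_integral]
  have hk := besselKernel_cont (x + k) z
  have e : ∀ t : ℝ, fourier (-x) (t : AddCircle (π - -π)) •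
      (((z * Real.cos t - k : ℝ) : ℂ) * besselKernel k z t)
      = ((z * Real.cos t - (x + k : ℤ) : ℝ) : ℂ) * besselKernel (x + k) z t
        + (x : ℂ) * besselKernel (x + k) z t := by
    intro t
    have e1 : fourier (-x) (t : AddCircle (π - -π)) * besselKernel k z t
        = besselKernel (x + k) z t := by
      rw [fourier_coe_apply]
      unfold besselKernel
      rw [← Complex.exp_add]
      congr 1
      have : (π : ℂ) ≠ 0 := by exact_mod_cast Real.pi_ne_zero
      push_cast
      field_simp
      ring
    rw [← e1, smul_eq_mul]
    push_cast
    ring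
  simp_rw [e]
  rw [intervalIntegral.integral_add (Continuous.intervalIntegrable (by fun_prop) _ _)
    (Continuous.intervalIntegrable (by fun_prop) _ _), integral_mul_besselKernel,
    intervalIntegral.integral_const_mul, integral_besselKernel]
  have : (π : ℂ) ≠ 0 := by exact_mod_cast Real.pi_ne_zero
  rw [Complex.real_smul]
  push_cast
  field_simp
  ring

lemma bessel_norm_integral (z : ℝ) (k : ℤ) :
    ∫ t in (-π)..π, ‖((z * Real.cos t - k : ℝ) : ℂ) * besselKernel k z t‖ ^ 2
      = 2 * π * (z ^ 2 / 2 + (k : ℝ) ^ 2) := by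
  have e : ∀ t : ℝ, ‖((z * Real.cos t - k : ℝ) : ℂ) * besselKernel k z t‖ ^ 2
      = z ^ 2 * Real.cos t ^ 2 - (2 * z * k) * Real.cos t + (k : ℝ) ^ 2 := by
    intro t
    rw [norm_mul, besselKernel, Complex.norm_exp_ofReal_mul_I, Complex.norm_real, mul_one,
      Real.norm_eq_abs, sq_abs]
    ring
  simp_rw [e]
  rw [intervalIntegral.integral_add (Continuous.intervalIntegrable (by fun_prop) _ _)
    (Continuous.intervalIntegrable (by fun_prop) _ _),
    intervalIntegral.integral_sub (Continuous.intervalIntegrable (by fun_prop) _ _)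
    (Continuous.intervalIntegrable (by fun_prop) _ _),
    intervalIntegral.integral_const_mul, intervalIntegral.integral_const_mul,
    integral_cos_sq, integral_cos, intervalIntegral.integral_const]
  simp
  ring

/-- `∑_{x ∈ ℤ} x² J_{x+k}(z)² = z²/2 + k²`, used in the computation of the second moment
of the directed quantum walk. -/
theorem diagonal_second_moment (z : ℝ) (k : ℤ) :
    Summable (fun x : ℤ => (x : ℝ) ^ 2 * besselJ (x + k) z ^ 2) ∧
    ∑' x : ℤ, (x : ℝ) ^ 2 * besselJ (x + k) z ^ 2 = z ^ 2 / 2 + (k : ℝ) ^ 2 := by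
  have hab : -π < π := by linarith [Real.pi_pos]
  have hk := besselKernel_cont k z
  have hL2 : MeasureTheory.MemLp
      (fun t => ((z * Real.cos t - k : ℝ) : ℂ) * besselKernel k z t) 2
      (MeasureTheory.volume.restrict (Set.Ioc (-π) π)) := by
    refine MeasureTheory.MemLp.of_bound (Continuous.aestronglyMeasurable (by fun_prop))
      (|z| + |(k : ℝ)|) (Filter.Eventually.of_forall fun t => ?_)
    rw [norm_mul, besselKernel, Complex.norm_exp_ofReal_mul_I, Complex.norm_real, mul_one,
      Real.norm_eq_abs]
    refine (abs_sub _ _).trans ?_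
    rw [abs_mul]
    have := mul_le_of_le_one_right (abs_nonneg z) (Real.abs_cos_le_one t)
    linarith
  have h := hasSum_sq_fourierCoeffOn hab hL2
  rw [bessel_norm_integral] at h
  have h' : HasSum (fun x : ℤ => (x : ℝ) ^ 2 * besselJ (x + k) z ^ 2)
      (z ^ 2 / 2 + (k : ℝ) ^ 2) := by
    convert h using 1
    · funext x
      rw [besselCoeff, Complex.norm_real, Real.norm_eq_abs, sq_abs, mul_pow]
    · have := Real.pi_ne_zero
      rw [smul_eq_mul]
      field_simp
      ring
  exact ⟨h'.summable, h'.tsum_eq⟩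
end

section
/- Let α, γ, θ, t ∈ ℝ and k ∈ ℤ with k ≠ 0, and define P_k(x,t) = cos²θ · J_{x+k}(2t)² + sin²θ · J_{x-k}(2t)² + 2(−1)^k cos(2αk + γ) · cos θ sin θ · J_{x+k}(2t) J_{x-k}(2t). Then the function x ↦ P_k(x,t) is summable over ℤ and ∑_{x ∈ ℤ} P_k(x,t) = 1; that is, the total probability of the directed quantum walk is conserved for all times t. -/
open scoped Real

open MeasureTheory in
lemma bj_integral (n : ℤ) (z : ℝ) :
    ∫ τ in (-Real.pi)..Real.pi, Complex.exp (-(Complex.I * ((n * τ - z * Real.sin τ : ℝ) : ℂ)))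
      = ((2 * Real.pi * besselJ n z : ℝ) : ℂ) := by
  have hc : Continuous (fun τ : ℝ =>
      Complex.exp (-(Complex.I * ((n * τ - z * Real.sin τ : ℝ) : ℂ)))) := by fun_prop
  rw [← intervalIntegral.integral_add_adjacent_intervals
    (hc.intervalIntegrable (-Real.pi) 0) (hc.intervalIntegrable 0 Real.pi)]
  have h1 := intervalIntegral.integral_comp_neg (a := 0) (b := Real.pi) (fun τ : ℝ =>
      Complex.exp (-(Complex.I * ((n * τ - z * Real.sin τ : ℝ) : ℂ))))
  rw [neg_zero] at h1
  rw [← h1, ← intervalIntegral.integral_add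
    (Continuous.intervalIntegrable (by fun_prop) 0 Real.pi) (hc.intervalIntegrable 0 Real.pi)]
  have h2 : ∀ τ : ℝ, Complex.exp (-(Complex.I * ((n * (-τ) - z * Real.sin (-τ) : ℝ) : ℂ)))
      + Complex.exp (-(Complex.I * ((n * τ - z * Real.sin τ : ℝ) : ℂ)))
      = ((2 * Real.cos (n * τ - z * Real.sin τ) : ℝ) : ℂ) := by
    intro τ
    have e : (n * (-τ) - z * Real.sin (-τ) : ℝ) = -(n * τ - z * Real.sin τ) := by
      rw [Real.sin_neg]; ring
    rw [e]
    generalize (n * τ - z * Real.sin τ : ℝ) = w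
    push_cast
    rw [Complex.two_cos]
    ring_nf
  rw [intervalIntegral.integral_congr (fun τ _ => h2 τ), intervalIntegral.integral_ofReal,
    intervalIntegral.integral_const_mul]
  congr 1
  unfold besselJ
  have := Real.pi_ne_zero
  field_simp

lemma int_cos_two (k : ℤ) (hk : k ≠ 0) :
    ∫ τ in (-Real.pi)..Real.pi, Real.cos (2 * k * τ) = 0 := by
  have hk' : (2 * k : ℝ) ≠ 0 := by
    have : (k : ℝ) ≠ 0 := by exact_mod_cast hk
    positivity
  rw [intervalIntegral.integral_comp_mul_left (fun x => Real.cos x) hk', integral_cos]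
  have h : Real.sin (2 * k * Real.pi) = 0 := by
    have := Real.sin_int_mul_pi (2 * k)
    push_cast at this
    exact this
  rw [mul_neg, Real.sin_neg, h]
  simp

/-- The auxiliary function. -/
noncomputable def auxF (a b : ℝ) (k : ℤ) (z : ℝ) (τ : ℝ) : ℂ :=
  Complex.exp (Complex.I * ((z * Real.sin τ : ℝ) : ℂ)) *
    (a * Complex.exp (-(Complex.I * ((k * τ : ℝ) : ℂ))) + b * Complex.exp (Complex.I * ((k * τ : ℝ) : ℂ)))

lemma auxF_cont (a b : ℝ) (k : ℤ) (z : ℝ) : Continuous (auxF a b k z) := by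
  unfold auxF; fun_prop

lemma auxF_norm (a b : ℝ) (k : ℤ) (z τ : ℝ) :
    ‖auxF a b k z τ‖ ^ 2 = (a ^ 2 + b ^ 2) + 2 * a * b * Real.cos (2 * k * τ) := by
  unfold auxF
  rw [norm_mul, mul_comm Complex.I ((z * Real.sin τ : ℝ) : ℂ), Complex.norm_exp_ofReal_mul_I, one_mul,
    ← Complex.normSq_eq_norm_sq]
  have e1 : -(Complex.I * ((k * τ : ℝ) : ℂ)) = ((-(k * τ) : ℝ) : ℂ) * Complex.I := by
    push_cast; ring
  rw [e1, mul_comm Complex.I, mul_assoc 2 (k : ℝ) τ]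
  generalize (k * τ : ℝ) = w
  rw [Complex.normSq_apply]
  simp only [Complex.add_re, Complex.add_im, Complex.re_ofReal_mul, Complex.im_ofReal_mul,
    Complex.exp_ofReal_mul_I_re, Complex.exp_ofReal_mul_I_im, Real.cos_neg, Real.sin_neg]
  rw [Real.cos_two_mul]
  linear_combination (a - b) ^ 2 * Real.sin_sq_add_cos_sq w

lemma lt_pi : -Real.pi < Real.pi := by linarith [Real.pi_pos]

lemma auxF_coeff (a b : ℝ) (k : ℤ) (z : ℝ) (n : ℤ) :
    fourierCoeffOn lt_pi (auxF a b k z) n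
      = ((a * besselJ (n + k) z + b * besselJ (n - k) z : ℝ) : ℂ) := by
  have hp : (Real.pi : ℂ) ≠ 0 := by exact_mod_cast Real.pi_ne_zero
  rw [fourierCoeffOn_eq_integral]
  have h : ∀ τ : ℝ, (fourier (-n) (τ : AddCircle (Real.pi - -Real.pi)) : ℂ) • auxF a b k z τ
      = a * Complex.exp (-(Complex.I * (((n + k : ℤ) * τ - z * Real.sin τ : ℝ) : ℂ)))
      + b * Complex.exp (-(Complex.I * (((n - k : ℤ) * τ - z * Real.sin τ : ℝ) : ℂ))) := by
    intro τ
    have e0 : 2 * (Real.pi : ℂ) * Complex.I * ((-n : ℤ) : ℂ) * τ / ((Real.pi - -Real.pi : ℝ) : ℂ)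
        = -(Complex.I * (n * τ)) := by
      push_cast
      field_simp
      ring
    rw [fourier_coe_apply, e0, auxF, smul_eq_mul, mul_add, mul_add]
    congr 1
    · rw [show ∀ x y z w : ℂ, x * (y * (z * w)) = z * (x * y * w) by intros; ring,
        ← Complex.exp_add, ← Complex.exp_add]
      congr 2; push_cast; ring
    · rw [show ∀ x y z w : ℂ, x * (y * (z * w)) = z * (x * y * w) by intros; ring,
        ← Complex.exp_add, ← Complex.exp_add]
      congr 2; push_cast; ring
  rw [intervalIntegral.integral_congr (fun τ _ => h τ), intervalIntegral.integral_add
    (Continuous.intervalIntegrable (by fun_prop) _ _)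
    (Continuous.intervalIntegrable (by fun_prop) _ _),
    intervalIntegral.integral_const_mul, intervalIntegral.integral_const_mul,
    bj_integral, bj_integral, Complex.real_smul]
  push_cast
  field_simp
  ring

open MeasureTheory in
lemma hasSum_aux (a b : ℝ) (k : ℤ) (hk : k ≠ 0) (z : ℝ) :
    HasSum (fun n : ℤ => (a * besselJ (n + k) z + b * besselJ (n - k) z) ^ 2) (a ^ 2 + b ^ 2) := by
  have hL : MemLp (auxF a b k z) 2 (volume.restrict (Set.Ioc (-Real.pi) Real.pi)) :=
    (memLp_two_iff_integrable_sq_norm (auxF_cont a b k z).aestronglyMeasurable).2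
      (((auxF_cont a b k z).norm.pow 2).intervalIntegrable (-Real.pi) Real.pi).1
  have h := hasSum_sq_fourierCoeffOn lt_pi hL
  simp only [auxF_coeff, auxF_norm, Complex.norm_real, Real.norm_eq_abs, sq_abs] at h
  rw [intervalIntegral.integral_add (by simp)
    (Continuous.intervalIntegrable (by fun_prop) _ _), intervalIntegral.integral_const_mul,
    int_cos_two k hk, intervalIntegral.integral_const] at h
  convert h using 1
  have := Real.pi_ne_zero
  simp only [smul_eq_mul]
  field_simp
  ring

/-- Conservation of total probability: for `k ≠ 0`, `∑_{x ∈ ℤ} P_k(x,t) = 1` at all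
times `t`. -/
theorem total_probability (α γ θ t : ℝ) (k : ℤ) (hk : k ≠ 0) :
    Summable (fun x : ℤ => P α γ θ k x t) ∧
    ∑' x : ℤ, P α γ θ k x t = 1 := by
  suffices h : HasSum (fun x : ℤ => P α γ θ k x t) 1 from ⟨h.summable, h.tsum_eq⟩
  have h10 := hasSum_aux 1 0 k hk (2 * t)
  have h01 := hasSum_aux 0 1 k hk (2 * t)
  have h11 := hasSum_aux 1 1 k hk (2 * t)
  have h := ((h10.mul_left (Real.cos θ ^ 2)).add (h01.mul_left (Real.sin θ ^ 2))).add
    (((h11.sub h10).sub h01).mul_left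
      ((-1 : ℝ) ^ k * Real.cos (2 * α * k + γ) * Real.cos θ * Real.sin θ))
  have e2 : Real.cos θ ^ 2 * (1 ^ 2 + 0 ^ 2) + Real.sin θ ^ 2 * (0 ^ 2 + 1 ^ 2) +
      (-1) ^ k * Real.cos (2 * α * k + γ) * Real.cos θ * Real.sin θ *
        (1 ^ 2 + 1 ^ 2 - (1 ^ 2 + 0 ^ 2) - (0 ^ 2 + 1 ^ 2)) = (1 : ℝ) := by
    linear_combination Real.sin_sq_add_cos_sq θ
  rw [e2] at h
  refine (funext fun x => ?_ : (fun x : ℤ => P α γ θ k x t) = _) ▸ h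
  unfold P
  ring
end
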